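/- Let K : ℕ₀×ℕ₀ → [0,∞) be a symmetric kernel (K_{j,k} = K_{k,j}) satisfying K_{j,k} ≤ C_q (j^μ k^ν + j^ν k^μ) for all j,k ∈ ℕ₀, where μ, ν ∈ [0,2], μ + ν ≤ 3, and C_q > 0, and set λ := max{μ,ν}. Assume λ > 1 and let f(0) = (f_j(0))_{j≥0} ∈ Y_λ^+. Then the EDG system has a global mild solution f = (f_j)_{j≥0} on [0,∞) such that f(t) ∈ Y_λ^+ for every t ∈ [0,∞). -/

import Mathlib

open MeasureTheory Filter

noncomputable section

/-- Membership in the positive cone `Y_r^+`: componentwise nonnegative sequences with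
`∑ j^r f_j < ∞`. -/
def MemYplus (r : ℝ) (g : ℕ → ℝ) : Prop :=
  (∀ j, 0 ≤ g j) ∧ Summable (fun j : ℕ => (j : ℝ) ^ r * g j)

/-- The `p`-th moment `M_p(g) = ∑_{j=0}^∞ j^p g_j`. -/
def mom (p : ℝ) (g : ℕ → ℝ) : ℝ := ∑' j : ℕ, (j : ℝ) ^ p * g j

/-- Right-hand side of the infinite EDG system. -/
def edgRHS (K : ℕ → ℕ → ℝ) (g : ℕ → ℝ) : ℕ → ℝ
  | 0 => g 1 * (∑' k : ℕ, K 1 k * g k) - g 0 * (∑' k : ℕ, K (k + 1) 0 * g (k + 1))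
  | m + 1 =>
      g (m + 2) * (∑' k : ℕ, K (m + 2) k * g k) - g (m + 1) * (∑' k : ℕ, K (m + 1) k * g k)
        - g (m + 1) * (∑' k : ℕ, K (k + 1) (m + 1) * g (k + 1))
        + g m * (∑' k : ℕ, K (k + 1) m * g (k + 1))

/-- Mild solution of the EDG system on a time set `S` (containing `0`), with values in
`Y_r^+`. -/
def IsMildSolutionOn (K : ℕ → ℕ → ℝ) (r : ℝ) (f : ℝ → ℕ → ℝ) (S : Set ℝ) : Prop :=
  (∀ t ∈ S, MemYplus r (f t)) ∧
  (∀ j : ℕ, ContinuousOn (fun t => f t j) S) ∧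
  (∃ B : ℝ, ∀ t ∈ S, (∑' j : ℕ, (j : ℝ) ^ r * f t j) ≤ B) ∧
  (∀ t ∈ S, ∀ j : ℕ, Summable (fun k : ℕ => K j k * f t k)) ∧
  (∀ t ∈ S, ∀ j : ℕ,
    MeasureTheory.IntegrableOn (fun s => ∑' k : ℕ, K j k * f s k) (Set.Icc 0 t)) ∧
  (∀ t ∈ S, f t 0 = f 0 0 + ∫ s in (0:ℝ)..t,
      (f s 1 * (∑' k : ℕ, K 1 k * f s k) - f s 0 * (∑' k : ℕ, K (k + 1) 0 * f s (k + 1)))) ∧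
  (∀ t ∈ S, ∀ m : ℕ, f t (m + 1) = f 0 (m + 1) + ∫ s in (0:ℝ)..t,
      (f s (m + 2) * (∑' k : ℕ, K (m + 2) k * f s k)
        - f s (m + 1) * (∑' k : ℕ, K (m + 1) k * f s k)
        - f s (m + 1) * (∑' k : ℕ, K (k + 1) (m + 1) * f s (k + 1))
        + f s m * (∑' k : ℕ, K (k + 1) m * f s (k + 1))))

/-- Classical (continuously differentiable) solution of the EDG system on a time set `S`. -/
def IsClassicalSolutionOn (K : ℕ → ℕ → ℝ) (f : ℝ → ℕ → ℝ) (S : Set ℝ) : Prop :=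
  (∀ t ∈ S, ∀ j : ℕ, Summable (fun k : ℕ => K j k * f t k) ∧
      Summable (fun k : ℕ => K (k + 1) j * f t (k + 1))) ∧
  (∀ t ∈ S, ∀ j : ℕ, HasDerivWithinAt (fun s => f s j) (edgRHS K (f t) j) S t) ∧
  (∀ j : ℕ, ContinuousOn (fun t => edgRHS K (f t) j) S)

/-- Right-hand side of the truncated EDG system with `N+1` equations. -/
def truncRHS (K : ℕ → ℕ → ℝ) (N : ℕ) (g : ℕ → ℝ) (j : ℕ) : ℝ :=
  if j = 0 then
    g 1 * (∑ k ∈ Finset.range N, K 1 k * g k) - g 0 * (∑ k ∈ Finset.Icc 1 N, K k 0 * g k)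
  else if j = N then
    - g N * (∑ k ∈ Finset.range N, K N k * g k)
      + g (N - 1) * (∑ k ∈ Finset.Icc 1 N, K k (N - 1) * g k)
  else
    g (j + 1) * (∑ k ∈ Finset.range N, K (j + 1) k * g k)
      - g j * (∑ k ∈ Finset.range N, K j k * g k)
      - g j * (∑ k ∈ Finset.Icc 1 N, K k j * g k)
      + g (j - 1) * (∑ k ∈ Finset.Icc 1 N, K k (j - 1) * g k)

/-- `fN` is a (global, `C¹`) solution of the truncated EDG system of size `N`. -/
def IsTruncSolution (K : ℕ → ℕ → ℝ) (N : ℕ) (fN : ℝ → ℕ → ℝ) : Prop :=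
  ∀ t : ℝ, ∀ j ≤ N, HasDerivAt (fun s => fN s j) (truncRHS K N (fN t) j) t

/-- The gelation time `T_gel = inf { t ≥ 0 : ∑ j f_j(t) < ∑ j f_j(0) }`. -/
def gelTime (f : ℝ → ℕ → ℝ) : ℝ :=
  sInf { t : ℝ | 0 ≤ t ∧ (∑' j : ℕ, (j : ℝ) * f t j) < ∑' j : ℕ, (j : ℝ) * f 0 j }

/-- The class `𝒢_{1,∞}`: a nonnegative convex `C²` function `G` on `[0,∞)` with derivative
`G'`, such that `G(0) = G'(0) = 0`, `G'` is concave and positive on `(0,∞)`, and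
`G'(x) → ∞`, `G(x)/x → ∞` as `x → ∞`. -/
structure G1Inf where
  G : ℝ → ℝ
  G' : ℝ → ℝ
  hasDeriv : ∀ x ∈ Set.Ici (0:ℝ), HasDerivWithinAt G (G' x) (Set.Ici 0) x
  contDiff : ContDiffOn ℝ 2 G (Set.Ici 0)
  nonneg : ∀ x ∈ Set.Ici (0:ℝ), 0 ≤ G x
  convex : ConvexOn ℝ (Set.Ici 0) G
  zero : G 0 = 0
  deriv_zero : G' 0 = 0
  concave_deriv : ConcaveOn ℝ (Set.Ici 0) G'
  deriv_pos : ∀ x : ℝ, 0 < x → 0 < G' x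
  tendsto_deriv : Filter.Tendsto G' Filter.atTop Filter.atTop
  tendsto_div : Filter.Tendsto (fun x => G x / x) Filter.atTop Filter.atTop

end


section Auxiliary

open Set Finset
open scoped NNReal Topology

/-! ### Weights -/

/-- A bound for `(x + s) ^ p` with `p ≤ 2`, comparing with a quadratic. -/
lemma rpow_add_le_quadratic {p x s : ℝ} (hp0 : 0 ≤ p) (hp2 : p ≤ 2) (hx : 0 < x)
    (hs : 0 ≤ x + s) :
    (x + s) ^ p ≤ x ^ p + p / 2 * x ^ (p - 2) * (2 * s * x + s ^ 2) := by
  have hx2 : 0 < x ^ 2 := by positivity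
  have h1 : (x + s) ^ p = x ^ p * (1 + (2 * s * x + s ^ 2) / x ^ 2) ^ (p / 2) := by
    have e : 1 + (2 * s * x + s ^ 2) / x ^ 2 = ((x + s) / x) ^ (2 : ℝ) := by
      rw [Real.rpow_two]; field_simp; ring
    rw [e, ← Real.rpow_mul (by positivity), Real.div_rpow hs hx.le]
    have : 2 * (p / 2) = p := by ring
    rw [this]
    field_simp
  have hb : (1 + (2 * s * x + s ^ 2) / x ^ 2) ^ (p / 2)
      ≤ 1 + p / 2 * ((2 * s * x + s ^ 2) / x ^ 2) := by
    apply rpow_one_add_le_one_add_mul_self _ (by positivity) (by linarith)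
    rw [le_div_iff₀ hx2]
    nlinarith [sq_nonneg (x + s)]
  have h2 : x ^ (p - 2) = x ^ p / x ^ 2 := by
    rw [Real.rpow_sub hx, Real.rpow_two]
  rw [h1, h2]
  calc _ ≤ x ^ p * (1 + p / 2 * ((2 * s * x + s ^ 2) / x ^ 2)) :=
        mul_le_mul_of_nonneg_left hb (by positivity)
    _ = _ := by ring

/-- Bernoulli's inequality in homogeneous form. -/
lemma rpow_sub_one_ge {p x : ℝ} (hp : 1 ≤ p) (hx : 1 ≤ x) :
    x ^ p - p * x ^ (p - 1) ≤ (x - 1) ^ p := by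
  have hx0 : 0 < x := by linarith
  have h1 : (x - 1) ^ p = x ^ p * (1 + -1 / x) ^ p := by
    have e : 1 + -1 / x = (x - 1) / x := by field_simp; ring
    rw [e, Real.div_rpow (by linarith) hx0.le]
    field_simp
  have hb : 1 + p * (-1 / x) ≤ (1 + -1 / x) ^ p := by
    apply one_add_mul_self_le_rpow_one_add _ hp
    rw [le_div_iff₀ hx0]; linarith
  rw [h1, Real.rpow_sub_one hx0.ne']
  calc _ = x ^ p * (1 + p * (-1 / x)) := by ring
    _ ≤ _ := mul_le_mul_of_nonneg_left hb (by positivity)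

/-- The weight `x ^ p * min 1 (x / R)`, comparable to `x ^ p` beyond `R` and small before. -/
noncomputable def tailWeight (p R x : ℝ) : ℝ := x ^ p * min 1 (x / R)

lemma tailWeight_nonneg {p R x : ℝ} (hR : 1 ≤ R) (hx : 0 ≤ x) : 0 ≤ tailWeight p R x := by
  unfold tailWeight; positivity

lemma tailWeight_le {p R x : ℝ} (hx : 0 ≤ x) : tailWeight p R x ≤ x ^ p :=
  mul_le_of_le_one_right (by positivity) (min_le_left _ _)

lemma tailWeight_eq_of_le {p R x : ℝ} (hR : 1 ≤ R) (hx : R ≤ x) : tailWeight p R x = x ^ p := by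
  unfold tailWeight
  rw [min_eq_left, mul_one]
  rw [le_div_iff₀ (by linarith)]; linarith

lemma tailWeight_zero {p R : ℝ} : tailWeight p R 0 = 0 := by
  unfold tailWeight; simp

lemma tailWeight_second_diff_le {p R x : ℝ} (hp1 : 1 ≤ p) (hp2 : p ≤ 2) (hR : 1 ≤ R)
    (hx : 1 ≤ x) :
    tailWeight p R (x - 1) - 2 * tailWeight p R x + tailWeight p R (x + 1)
      ≤ 7 * (x ^ (p - 2) * min 1 (x / R)) := by
  unfold tailWeight
  have hx0 : 0 < x := by linarith
  have hR0 : 0 < R := by linarith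
  set L := min 1 (x / R) with hL
  set L' := min 1 ((x - 1) / R) with hL'
  have hL0 : 0 ≤ L := by positivity
  have hd0 : L' ≤ L := by
    apply min_le_min le_rfl; gcongr; linarith
  have hconc : min 1 ((x + 1) / R) ≤ L + (L - L') := by
    have e1 : (x + 1) / R = x / R + 1 / R := by ring
    have e2 : (x - 1) / R = x / R - 1 / R := by ring
    have h3 : 0 < 1 / R := by positivity
    rw [hL, hL', e1, e2]
    rcases le_total 1 (x / R) with h | h
    · have := min_le_left 1 (x / R + 1 / R)
      have := min_le_left 1 (x / R - 1 / R)
      rw [min_eq_left h]; linarith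
    · have := min_le_right 1 (x / R + 1 / R)
      have := min_le_right 1 (x / R - 1 / R)
      rw [min_eq_right h]; linarith
  have hd : (L - L') * x ≤ L := by
    have : (x - 1) * L ≤ x * L' := by
      rw [hL, hL', mul_min_of_nonneg _ _ (by linarith), mul_min_of_nonneg _ _ hx0.le]
      apply min_le_min
      · linarith
      · apply le_of_eq; ring
    linarith
  have q1 := rpow_add_le_quadratic (p := p) (x := x) (s := 1) (by linarith) hp2 hx0 (by linarith)
  have q2 := rpow_add_le_quadratic (p := p) (x := x) (s := -1) (by linarith) hp2 hx0 (by linarith)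
  have q3 := rpow_sub_one_ge hp1 hx
  have e1 : x ^ (p - 1) = x ^ (p - 2) * x := by
    rw [← Real.rpow_add_one hx0.ne']; congr 1; ring
  have eq : x + -1 = x - 1 := by ring
  rw [eq] at q2
  rw [e1] at q3
  set w := x ^ (p - 2)
  have hw : 0 ≤ w := by positivity
  have hpos : 0 ≤ (x + 1) ^ p := by positivity
  set P := x ^ p
  set P1 := (x + 1) ^ p
  set P0 := (x - 1) ^ p
  have s1 : P0 - 2 * P + P1 ≤ 2 * w := by nlinarith
  have s2 : P1 - P0 ≤ 5 * w * x := by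
    have : w ≤ w * x := by nlinarith
    have : 0 ≤ w * x := by positivity
    nlinarith
  calc P0 * L' - 2 * (P * L) + P1 * min 1 ((x + 1) / R)
      ≤ P0 * L' - 2 * (P * L) + P1 * (L + (L - L')) := by gcongr
    _ = L * (P0 - 2 * P + P1) + (L - L') * (P1 - P0) := by ring
    _ ≤ L * (2 * w) + (L - L') * (5 * w * x) := by
        gcongr
    _ = L * (2 * w) + 5 * w * ((L - L') * x) := by ring
    _ ≤ L * (2 * w) + 5 * w * L := by gcongr
    _ = _ := by ring

/-- The first increment of the weight is its smallest one. -/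
lemma tailWeight_one_le_sub {p R x : ℝ} (hp1 : 1 ≤ p) (hR : 1 ≤ R) (hx : 1 ≤ x) :
    tailWeight p R 1 ≤ tailWeight p R x - tailWeight p R (x - 1) := by
  unfold tailWeight
  have hR0 : 0 < R := by linarith
  have h1 : (x - 1) ^ p + 1 ≤ x ^ p := by
    have := Real.add_rpow_le_rpow_add (a := x - 1) (b := 1) (by linarith) zero_le_one hp1
    simpa using this
  have h2 : min 1 ((x - 1) / R) ≤ min 1 (x / R) := by
    apply min_le_min le_rfl; gcongr; linarith
  have h3 : min 1 (1 / R) ≤ min 1 (x / R) := by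
    apply min_le_min le_rfl; gcongr
  have h4 : 0 ≤ (x - 1) ^ p := Real.rpow_nonneg (by linarith) _
  have h5 : 0 ≤ min 1 (x / R) := by
    have : 0 ≤ x := by linarith
    positivity
  rw [Real.one_rpow, one_mul]
  nlinarith [mul_le_mul_of_nonneg_left h2 h4, mul_le_mul_of_nonneg_right h1 h5]

lemma rpow_mul_rpow_mul_min_le {p R a b x y : ℝ} (hR : 1 ≤ R) (ha : a ≤ p) (hb : b ≤ p)
    (hab : a + b ≤ p + 1) (hx : 1 ≤ x) (hy : 1 ≤ y) :
    x ^ a * y ^ b * min 1 (x / R) ≤ tailWeight p R x * y + x * tailWeight p R y := by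
  have key : ∀ {a b x y : ℝ}, a ≤ p → b ≤ p → a + b ≤ p + 1 → 1 ≤ x → 1 ≤ y → y ≤ x →
      x ^ a * y ^ b ≤ x ^ p * y := by
    intro a b x y ha hb hab hx hy hyx
    have hy0 : 0 < y := by linarith
    have hx0 : 0 < x := by linarith
    rcases le_total b 1 with h | h
    · have h1 : x ^ a ≤ x ^ p := Real.rpow_le_rpow_of_exponent_le hx ha
      have h2 : y ^ b ≤ y ^ (1 : ℝ) := Real.rpow_le_rpow_of_exponent_le hy h
      rw [Real.rpow_one] at h2
      gcongr
    · have e : y ^ b = y ^ (b - 1) * y := by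
        rw [← Real.rpow_add_one hy0.ne']; congr 1; ring
      have h1 : y ^ (b - 1) ≤ x ^ (b - 1) := Real.rpow_le_rpow hy0.le hyx (by linarith)
      have h2 : x ^ a * x ^ (b - 1) ≤ x ^ p := by
        rw [← Real.rpow_add hx0]
        exact Real.rpow_le_rpow_of_exponent_le hx (by linarith)
      calc x ^ a * y ^ b = x ^ a * y ^ (b - 1) * y := by rw [e]; ring
        _ ≤ x ^ a * x ^ (b - 1) * y := by gcongr
        _ ≤ _ := by gcongr
  have hx0 : 0 < x := by linarith
  have hy0 : 0 < y := by linarith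
  have hR0 : 0 < R := by linarith
  have n1 := tailWeight_nonneg (p := p) hR hx0.le
  have n2 := tailWeight_nonneg (p := p) hR hy0.le
  rcases le_total y x with h | h
  · calc _ ≤ x ^ p * y * min 1 (x / R) := by
          gcongr ?_ * min 1 (x / R); exact key ha hb hab hx hy h
      _ = tailWeight p R x * y := by unfold tailWeight; ring
      _ ≤ _ := by nlinarith
  · calc _ ≤ y ^ p * x * min 1 (y / R) := by
          gcongr ?_ * min 1 (?_ / R)
          rw [mul_comm (x ^ a)]
          exact key hb ha (by linarith) hy hx h
      _ = x * tailWeight p R y := by unfold tailWeight; ring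
      _ ≤ _ := by nlinarith
/-! ### Existence for bounded Lipschitz vector fields -/

lemma exists_hasDerivWithinAt_of_lipschitz_of_bounded {E : Type*} [NormedAddCommGroup E]
    [NormedSpace ℝ E] [CompleteSpace E] {F : E → E} {L B : ℝ≥0} (hL : LipschitzWith L F)
    (hB : ∀ x, ‖F x‖ ≤ B) (x₀ : E) {T : ℝ} (hT : 0 ≤ T) :
    ∃ u : ℝ → E, u 0 = x₀ ∧ ∀ t ∈ Icc 0 T, HasDerivWithinAt u (F (u t)) (Icc 0 T) t := by
  have hPL : IsPicardLindelof (fun _ => F) (tmin := 0) (tmax := T) ⟨0, by simp [hT]⟩ x₀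
      (B * T.toNNReal) 0 B L :=
    { lipschitzOnWith := fun t _ => hL.lipschitzOnWith
      continuousOn := fun x _ => continuousOn_const
      norm_le := fun t _ x _ => hB x
      mul_max_le := by
        simp only [sub_zero, sub_self, NNReal.coe_mul, NNReal.coe_zero, Real.coe_toNNReal T hT]
        rw [max_eq_left hT] }
  obtain ⟨u, hu0, hu⟩ := hPL.exists_eq_forall_mem_Icc_hasDerivWithinAt₀
  exact ⟨u, hu0, hu⟩

/-- A function whose derivative is nonnegative wherever the function is negative stays
nonnegative. -/
lemma nonneg_of_deriv_nonneg_of_neg {g g' : ℝ → ℝ} {T : ℝ}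
    (hg : ∀ t ∈ Icc 0 T, HasDerivWithinAt g (g' t) (Icc 0 T) t) (h0 : 0 ≤ g 0)
    (hneg : ∀ t ∈ Icc 0 T, g t < 0 → 0 ≤ g' t) : ∀ t ∈ Icc 0 T, 0 ≤ g t := by
  intro t ht
  have key : ∀ ε > 0, -g t ≤ ε * (1 + t) := by
    intro ε hε
    refine image_le_of_deriv_right_lt_deriv_boundary (f := fun s => -g s) (f' := fun s => -g' s)
      (B := fun s => ε * (1 + s)) (B' := fun _ => ε) (a := 0) (b := T) ?_ ?_ ?_ ?_ ?_ ht
    · exact fun s hs => (hg s hs).continuousWithinAt.neg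
    · intro s hs
      exact ((hg s ⟨hs.1, hs.2.le⟩).mono_of_mem_nhdsWithin
        (Icc_mem_nhdsGE_of_mem hs)).neg
    · linarith
    · intro s
      simpa using ((hasDerivAt_id s).const_add 1).const_mul ε
    · intro s hs hse
      have : 0 < ε * (1 + s) := by have := hs.1; positivity
      have := hneg s ⟨hs.1, hs.2.le⟩ (by linarith)
      linarith
  have h1 : 0 < 1 + t := by linarith [ht.1]
  by_contra! hcon
  have := key (-g t / (2 * (1 + t))) (by apply div_pos <;> linarith)
  have e : -g t / (2 * (1 + t)) * (1 + t) = -g t / 2 := by field_simp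
  linarith

lemma le_mul_exp_of_deriv_le {g g' : ℝ → ℝ} {T C : ℝ}
    (hg : ∀ t ∈ Icc 0 T, HasDerivWithinAt g (g' t) (Icc 0 T) t)
    (hle : ∀ t ∈ Icc 0 T, g' t ≤ C * g t) : ∀ t ∈ Icc 0 T, g t ≤ g 0 * Real.exp (C * t) := by
  intro t ht
  have := le_gronwallBound_of_liminf_deriv_right_le (f := g) (f' := g') (δ := g 0) (K := C)
    (ε := 0) (a := 0) (b := T) (fun s hs => (hg s hs).continuousWithinAt)
    (fun s hs r hr => ((hg s ⟨hs.1, hs.2.le⟩).mono_of_mem_nhdsWithin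
        (Icc_mem_nhdsGE_of_mem hs)).liminf_right_slope_le hr) le_rfl
    (fun s hs => by simpa using hle s ⟨hs.1, hs.2.le⟩) t ht
  simpa [gronwallBound_ε0] using this

lemma eq_of_deriv_eq_zero {g : ℝ → ℝ} {T : ℝ}
    (hg : ∀ t ∈ Icc 0 T, HasDerivWithinAt g 0 (Icc 0 T) t) : ∀ t ∈ Icc 0 T, g t = g 0 := by
  intro t ht
  have := (convex_Icc 0 T).norm_image_sub_le_of_norm_hasDerivWithin_le (f := g) (C := 0) hg
    (by simp) (x := 0) (y := t) ⟨le_rfl, ht.1.trans ht.2⟩ ht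
  simpa [sub_eq_zero] using this

/-! ### The truncated system -/

/-- Net change at site `j` when a particle jumps from a cluster of size `a` to one of size `b`. -/
def jump (a b j : ℕ) : ℝ :=
  (if j = a - 1 then 1 else 0) - (if j = a then 1 else 0)
    + (if j = b + 1 then 1 else 0) - (if j = b then 1 else 0)

/-- Exchange vector field with the kernel restricted to sizes below `N`. -/
def exchField (K : ℕ → ℕ → ℝ) (N : ℕ) (g : ℕ → ℝ) (j : ℕ) : ℝ :=
  ∑ a ∈ Finset.Ico 1 N, ∑ b ∈ Finset.range N, K a b * (g a * g b) * jump a b j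

lemma abs_jump_le (a b j : ℕ) : |jump a b j| ≤ 4 := by
  unfold jump
  rw [abs_le]
  constructor <;> split_ifs <;> norm_num

/-- Weak formulation of the truncated system. -/
lemma sum_mul_exchField (K : ℕ → ℕ → ℝ) (N : ℕ) (g φ : ℕ → ℝ) :
    ∑ j ∈ Finset.range (N + 1), φ j * exchField K N g j
      = ∑ a ∈ Finset.Ico 1 N, ∑ b ∈ Finset.range N,
          K a b * (g a * g b) * (φ (a - 1) - φ a + φ (b + 1) - φ b) := by
  unfold exchField
  simp_rw [Finset.mul_sum]
  rw [Finset.sum_comm]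
  refine Finset.sum_congr rfl fun a ha => ?_
  rw [Finset.sum_comm]
  refine Finset.sum_congr rfl fun b hb => ?_
  rw [Finset.mem_Ico] at ha
  rw [Finset.mem_range] at hb
  have key : ∀ c ∈ Finset.range (N + 1),
      ∑ j ∈ Finset.range (N + 1), φ j * (if j = c then (1 : ℝ) else 0) = φ c := by
    intro c hc
    simp only [mul_ite, mul_one, mul_zero, Finset.sum_ite_eq', hc, if_true]
  rw [← key (a - 1) (by simp; omega), ← key a (by simp; omega),
    ← key (b + 1) (by simp; omega), ← key b (by simp; omega),
    ← Finset.sum_sub_distrib, ← Finset.sum_add_distrib, ← Finset.sum_sub_distrib, Finset.mul_sum]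
  refine Finset.sum_congr rfl fun j _ => ?_
  unfold jump
  ring

lemma exchField_congr {K : ℕ → ℕ → ℝ} {N : ℕ} {g h : ℕ → ℝ} (hgh : ∀ a < N, g a = h a) (j : ℕ) :
    exchField K N g j = exchField K N h j := by
  unfold exchField
  refine Finset.sum_congr rfl fun a ha => Finset.sum_congr rfl fun b hb => ?_
  rw [hgh a (Finset.mem_Ico.1 ha).2, hgh b (Finset.mem_range.1 hb)]

lemma exchField_nonneg_of_eq_zero {K : ℕ → ℕ → ℝ} (hK : ∀ j k, 0 ≤ K j k) {N : ℕ} {g : ℕ → ℝ}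
    (hg : ∀ a, 0 ≤ g a) {j : ℕ} (hj : g j = 0) : 0 ≤ exchField K N g j := by
  unfold exchField
  refine Finset.sum_nonneg fun a _ => Finset.sum_nonneg fun b _ => ?_
  have h0 : 0 ≤ K a b * (g a * g b) := mul_nonneg (hK a b) (mul_nonneg (hg a) (hg b))
  by_cases h : j = a ∨ j = b
  · have : g a * g b = 0 := by
      rcases h with rfl | rfl <;> simp [hj]
    simp [this]
  · push Not at h
    apply mul_nonneg h0
    unfold jump
    rw [if_neg h.1, if_neg h.2]
    split_ifs <;> norm_num

/-- The truncated system with clamped entries has a solution on every bounded interval. -/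
lemma exists_clamped_solution (K : ℕ → ℕ → ℝ) (N : ℕ) {f0 : ℕ → ℝ} {m : ℝ} (hm : 0 ≤ m)
    (h0 : ∀ j, 0 ≤ f0 j) (h0m : ∀ j, f0 j ≤ m) {T : ℝ} (hT : 0 ≤ T) :
    ∃ u : ℝ → ℕ → ℝ, u 0 = f0 ∧ ∀ t ∈ Icc 0 T, ∀ j,
      HasDerivWithinAt (fun s => u s j) (exchField K N (fun a => max 0 (min (u t a) m)) j)
        (Icc 0 T) t := by
  let e : ℕ → ℕ → BoundedContinuousFunction ℕ ℝ := fun a b =>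
    BoundedContinuousFunction.ofNormedAddCommGroupDiscrete (jump a b) 4 (abs_jump_le a b)
  let x₀ : BoundedContinuousFunction ℕ ℝ :=
    BoundedContinuousFunction.ofNormedAddCommGroupDiscrete f0 m (fun j => by
    rw [Real.norm_of_nonneg (h0 j)]; exact h0m j)
  let c : ℝ → ℝ := fun x => max 0 (min x m)
  have hc0 : ∀ x, 0 ≤ c x := fun x => le_max_left _ _
  have hcm : ∀ x, c x ≤ m := fun x => max_le hm (min_le_right _ _)
  have hcl : ∀ x y, |c x - c y| ≤ |x - y| := fun x y => by
    have h1 := abs_max_sub_max_le_max 0 (min x m) 0 (min y m)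
    have h2 := abs_min_sub_min_le_max x m y m
    simp only [sub_self, abs_zero, abs_nonneg, max_eq_right, max_eq_left] at h1 h2
    exact h1.trans h2
  let F : BoundedContinuousFunction ℕ ℝ → BoundedContinuousFunction ℕ ℝ := fun g =>
    ∑ a ∈ Finset.Ico 1 N, ∑ b ∈ Finset.range N, (K a b * (c (g a) * c (g b))) • e a b
  let S : ℝ := ∑ a ∈ Finset.Ico 1 N, ∑ b ∈ Finset.range N, |K a b| * ‖e a b‖
  have hS : 0 ≤ S := Finset.sum_nonneg fun a _ => Finset.sum_nonneg fun b _ => by positivity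
  have hFB : ∀ g, ‖F g‖ ≤ S * m ^ 2 := by
    intro g
    simp only [F, S, Finset.sum_mul]
    refine (norm_sum_le _ _).trans (Finset.sum_le_sum fun a _ => ?_)
    refine (norm_sum_le _ _).trans (Finset.sum_le_sum fun b _ => ?_)
    rw [norm_smul, norm_mul, Real.norm_eq_abs, Real.norm_of_nonneg (mul_nonneg (hc0 _) (hc0 _))]
    have : c (g a) * c (g b) ≤ m ^ 2 := by
      rw [sq]; exact mul_le_mul (hcm _) (hcm _) (hc0 _) hm
    calc _ = |K a b| * ‖e a b‖ * (c (g a) * c (g b)) := by ring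
      _ ≤ _ := by gcongr
  have hFL : LipschitzWith (S * (2 * m)).toNNReal F := by
    refine LipschitzWith.of_dist_le_mul fun g h => ?_
    rw [dist_eq_norm, dist_eq_norm]
    rw [Real.coe_toNNReal _ (by positivity)]
    simp only [F, S, Finset.sum_mul]
    rw [← Finset.sum_sub_distrib]
    refine (norm_sum_le _ _).trans (Finset.sum_le_sum fun a _ => ?_)
    rw [← Finset.sum_sub_distrib]
    refine (norm_sum_le _ _).trans (Finset.sum_le_sum fun b _ => ?_)
    have es : (K a b * (c (g a) * c (g b))) • e a b - (K a b * (c (h a) * c (h b))) • e a b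
        = (K a b * (c (g a) * c (g b) - c (h a) * c (h b))) • e a b := by
      ext i
      simp only [BoundedContinuousFunction.coe_sub, BoundedContinuousFunction.coe_smul,
        Pi.sub_apply, smul_eq_mul]
      ring
    rw [es, norm_smul, norm_mul, Real.norm_eq_abs, Real.norm_eq_abs]
    have hd : ∀ i, |c (g i) - c (h i)| ≤ ‖g - h‖ := fun i =>
      (hcl _ _).trans ((g - h).norm_coe_le_norm i)
    have : |c (g a) * c (g b) - c (h a) * c (h b)| ≤ 2 * m * ‖g - h‖ := by
      have e1 : c (g a) * c (g b) - c (h a) * c (h b)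
          = c (g a) * (c (g b) - c (h b)) + (c (g a) - c (h a)) * c (h b) := by ring
      rw [e1]
      refine (abs_add_le _ _).trans ?_
      rw [abs_mul, abs_mul, abs_of_nonneg (hc0 _), abs_of_nonneg (hc0 _)]
      have h1 : c (g a) * |c (g b) - c (h b)| ≤ m * ‖g - h‖ :=
        mul_le_mul (hcm _) (hd b) (abs_nonneg _) hm
      have h2 : |c (g a) - c (h a)| * c (h b) ≤ ‖g - h‖ * m :=
        mul_le_mul (hd a) (hcm _) (hc0 _) (norm_nonneg _)
      linarith
    calc _ = |K a b| * ‖e a b‖ * |c (g a) * c (g b) - c (h a) * c (h b)| := by ring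
      _ ≤ |K a b| * ‖e a b‖ * (2 * m * ‖g - h‖) := by gcongr
      _ = _ := by ring
  obtain ⟨u, hu0, hu⟩ := exists_hasDerivWithinAt_of_lipschitz_of_bounded hFL
    (B := ⟨S * m ^ 2, by positivity⟩) hFB x₀ hT
  refine ⟨fun t => u t, by simp only [hu0]; rfl, fun t ht j => ?_⟩
  have := (BoundedContinuousFunction.evalCLM ℝ (β := ℝ) j).hasFDerivAt.comp_hasDerivWithinAt t
    (hu t ht)
  convert! this using 1
  simp only [F, map_sum, map_smul]
  rfl
/-- Nonnegative solutions of the truncated system, with conserved number of clusters. -/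
lemma exists_truncated_solution {K : ℕ → ℕ → ℝ} (hK : ∀ j k, 0 ≤ K j k) (N : ℕ) {f0 : ℕ → ℝ}
    {m : ℝ} (h0 : ∀ j, 0 ≤ f0 j) (h0m : ∀ j, f0 j ≤ m)
    (hsum : ∑ j ∈ Finset.range (N + 1), f0 j ≤ m) {T : ℝ} (hT : 0 ≤ T) :
    ∃ u : ℝ → ℕ → ℝ, u 0 = f0 ∧ (∀ t ∈ Icc 0 T, ∀ j, 0 ≤ u t j) ∧
      (∀ t ∈ Icc 0 T, ∑ j ∈ Finset.range (N + 1), u t j ≤ m) ∧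
      ∀ t ∈ Icc 0 T, ∀ j,
        HasDerivWithinAt (fun s => u s j) (exchField K N (u t) j) (Icc 0 T) t := by
  have hm : 0 ≤ m := (h0 0).trans (h0m 0)
  obtain ⟨u, hu0, hu⟩ := exists_clamped_solution K N hm h0 h0m hT
  have hnn : ∀ t ∈ Icc 0 T, ∀ j, 0 ≤ u t j := by
    intro t ht j
    refine nonneg_of_deriv_nonneg_of_neg (fun s hs => hu s hs j) (by rw [hu0]; exact h0 j)
      (fun s hs hneg => exchField_nonneg_of_eq_zero hK (fun a => le_max_left _ _) ?_) t ht
    exact max_eq_left ((min_le_left _ _).trans hneg.le)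
  have hcons : ∀ t ∈ Icc 0 T, ∑ j ∈ Finset.range (N + 1), u t j ≤ m := by
    intro t ht
    have := eq_of_deriv_eq_zero (g := fun s => ∑ j ∈ Finset.range (N + 1), u s j) (T := T) ?_ t ht
    · rwa [this, hu0]
    · intro s hs
      have hd := HasDerivWithinAt.fun_sum (u := Finset.range (N + 1)) fun j _ => hu s hs j
      convert! hd using 1
      have := sum_mul_exchField K N (fun a => max 0 (min (u s a) m)) (fun _ => 1)
      simpa using this.symm
  refine ⟨u, hu0, hnn, hcons, fun t ht j => ?_⟩
  rw [exchField_congr (h := fun a => max 0 (min (u t a) m))]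
  · exact hu t ht j
  · intro a ha
    have : u t a ≤ m := (Finset.single_le_sum (fun i _ => hnn t ht i)
      (Finset.mem_range.2 (by omega))).trans (hcons t ht)
    rw [min_eq_left this, max_eq_right (hnn t ht a)]

lemma kernel_mul_second_diff_le {K : ℕ → ℕ → ℝ} {Cq μ ν p R : ℝ} (hK : ∀ j k, 0 ≤ K j k)
    (hCq : 0 ≤ Cq) (hμp : μ ≤ p) (hνp : ν ≤ p) (hp1 : 1 ≤ p) (hp2 : p ≤ 2) (hμν : μ + ν ≤ 3)
    (hKle : ∀ j k : ℕ, K j k ≤ Cq * ((j : ℝ) ^ μ * (k : ℝ) ^ ν + (j : ℝ) ^ ν * (k : ℝ) ^ μ))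
    (hR : 1 ≤ R) {a b : ℕ} (ha : 1 ≤ a) (hb : 1 ≤ b) :
    K a b * ((tailWeight p R (a - 1) - 2 * tailWeight p R a + tailWeight p R (a + 1))
      + (tailWeight p R (b - 1) - 2 * tailWeight p R b + tailWeight p R (b + 1)))
      ≤ 28 * Cq * (tailWeight p R a * b + a * tailWeight p R b) := by
  have hx : (1 : ℝ) ≤ a := by exact_mod_cast ha
  have hy : (1 : ℝ) ≤ b := by exact_mod_cast hb
  have hk := hKle a b
  have hk0 := hK a b
  have d1 := tailWeight_second_diff_le hp1 hp2 hR hx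
  have d2 := tailWeight_second_diff_le hp1 hp2 hR hy
  generalize K a b = k at hk hk0 ⊢
  generalize (a : ℝ) = x at *
  generalize (b : ℝ) = y at *
  have hx0 : 0 < x := by linarith
  have hy0 : 0 < y := by linarith
  have hR0 : 0 < R := by linarith
  have m1 : x ^ (μ + (p - 2)) * y ^ ν * min 1 (x / R) ≤ _ :=
    rpow_mul_rpow_mul_min_le (p := p) hR (by linarith) hνp (by linarith) hx hy
  have m2 : x ^ (ν + (p - 2)) * y ^ μ * min 1 (x / R) ≤ _ :=
    rpow_mul_rpow_mul_min_le (p := p) hR (by linarith) hμp (by linarith) hx hy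
  have m3 : y ^ (μ + (p - 2)) * x ^ ν * min 1 (y / R) ≤ _ :=
    rpow_mul_rpow_mul_min_le (p := p) hR (by linarith) hνp (by linarith) hy hx
  have m4 : y ^ (ν + (p - 2)) * x ^ μ * min 1 (y / R) ≤ _ :=
    rpow_mul_rpow_mul_min_le (p := p) hR (by linarith) hμp (by linarith) hy hx
  rw [Real.rpow_add hx0] at m1 m2
  rw [Real.rpow_add hy0] at m3 m4
  calc _ ≤ k * (7 * (x ^ (p - 2) * min 1 (x / R)) + 7 * (y ^ (p - 2) * min 1 (y / R))) := by
        gcongr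
    _ ≤ Cq * (x ^ μ * y ^ ν + x ^ ν * y ^ μ)
          * (7 * (x ^ (p - 2) * min 1 (x / R)) + 7 * (y ^ (p - 2) * min 1 (y / R))) := by
        gcongr
    _ = 7 * Cq * ((x ^ μ * x ^ (p - 2) * y ^ ν * min 1 (x / R)
          + x ^ ν * x ^ (p - 2) * y ^ μ * min 1 (x / R))
          + (y ^ μ * y ^ (p - 2) * x ^ ν * min 1 (y / R)
          + y ^ ν * y ^ (p - 2) * x ^ μ * min 1 (y / R))) := by ring
    _ ≤ 7 * Cq * (((tailWeight p R x * y + x * tailWeight p R y)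
          + (tailWeight p R x * y + x * tailWeight p R y))
          + ((tailWeight p R y * x + y * tailWeight p R x)
          + (tailWeight p R y * x + y * tailWeight p R x))) := by gcongr
    _ = _ := by ring

/-- The truncated dynamics increases weighted moments at most linearly. -/
lemma sum_tailWeight_mul_exchField_le {K : ℕ → ℕ → ℝ} {Cq μ ν p R : ℝ} (hK : ∀ j k, 0 ≤ K j k)
    (hKsym : ∀ j k, K j k = K k j)
    (hCq : 0 ≤ Cq) (hμp : μ ≤ p) (hνp : ν ≤ p) (hp1 : 1 ≤ p) (hp2 : p ≤ 2) (hμν : μ + ν ≤ 3)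
    (hKle : ∀ j k : ℕ, K j k ≤ Cq * ((j : ℝ) ^ μ * (k : ℝ) ^ ν + (j : ℝ) ^ ν * (k : ℝ) ^ μ))
    (hR : 1 ≤ R) (N : ℕ) {g : ℕ → ℝ} (hg : ∀ j, 0 ≤ g j) :
    ∑ j ∈ Finset.range (N + 1), tailWeight p R j * exchField K N g j
      ≤ 28 * Cq * (∑ j ∈ Finset.range (N + 1), j * g j)
        * ∑ j ∈ Finset.range (N + 1), tailWeight p R j * g j := by
  set φ : ℕ → ℝ := fun j => tailWeight p R j with hφ
  have hφ0 : ∀ j, 0 ≤ φ j := fun j => tailWeight_nonneg hR (Nat.cast_nonneg j)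
  change ∑ j ∈ Finset.range (N + 1), φ j * exchField K N g j ≤ 28 * Cq * _ *
    ∑ j ∈ Finset.range (N + 1), φ j * g j
  rw [sum_mul_exchField]
  have hs1 : ∑ j ∈ Finset.Ico 1 N, (j : ℝ) * g j ≤ ∑ j ∈ Finset.range (N + 1), (j : ℝ) * g j :=
    Finset.sum_le_sum_of_subset_of_nonneg
      (fun j hj => by simp only [Finset.mem_Ico, Finset.mem_range] at *; omega)
      (fun j _ _ => mul_nonneg (Nat.cast_nonneg j) (hg j))
  have hs2 : ∑ j ∈ Finset.Ico 1 N, φ j * g j ≤ ∑ j ∈ Finset.range (N + 1), φ j * g j :=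
    Finset.sum_le_sum_of_subset_of_nonneg
      (fun j hj => by simp only [Finset.mem_Ico, Finset.mem_range] at *; omega)
      (fun j _ _ => mul_nonneg (hφ0 j) (hg j))
  have n1 : 0 ≤ ∑ j ∈ Finset.Ico 1 N, (j : ℝ) * g j :=
    Finset.sum_nonneg fun j _ => mul_nonneg (Nat.cast_nonneg j) (hg j)
  have n2 : 0 ≤ ∑ j ∈ Finset.Ico 1 N, φ j * g j :=
    Finset.sum_nonneg fun j _ => mul_nonneg (hφ0 j) (hg j)
  set Φ : ℕ → ℕ → ℝ := fun a b =>
    K a b * (g a * g b) * (φ (a - 1) - φ a + φ (b + 1) - φ b) with hΦ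
  have hzero : ∀ a ∈ Finset.Ico 1 N, Φ a 0 ≤ 0 := by
    intro a ha
    have ha1 : 1 ≤ a := (Finset.mem_Ico.1 ha).1
    have h1 := tailWeight_one_le_sub (p := p) (R := R) (x := a) hp1 hR (by exact_mod_cast ha1)
    refine mul_nonpos_of_nonneg_of_nonpos (mul_nonneg (hK _ _) (mul_nonneg (hg _) (hg _))) ?_
    simp only [hφ, Nat.cast_sub ha1, Nat.cast_one, zero_add, Nat.cast_zero, tailWeight_zero]
    linarith
  have hsplit : ∑ a ∈ Finset.Ico 1 N, ∑ b ∈ Finset.range N, Φ a b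
      ≤ ∑ a ∈ Finset.Ico 1 N, ∑ b ∈ Finset.Ico 1 N, Φ a b := by
    refine Finset.sum_le_sum fun a ha => ?_
    have hN : 0 < N := by have := Finset.mem_Ico.1 ha; omega
    rw [Finset.range_eq_Ico, Finset.sum_eq_sum_Ico_succ_bot hN]
    linarith [hzero a ha]
  have hpair : ∀ a ∈ Finset.Ico 1 N, ∀ b ∈ Finset.Ico 1 N,
      Φ a b + Φ b a ≤ 28 * Cq * ((φ a * g a) * (b * g b) + (a * g a) * (φ b * g b)) := by
    intro a ha b hb
    have ha1 : 1 ≤ a := (Finset.mem_Ico.1 ha).1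
    have hb1 : 1 ≤ b := (Finset.mem_Ico.1 hb).1
    have h := kernel_mul_second_diff_le hK hCq hμp hνp hp1 hp2 hμν hKle hR ha1 hb1
    have h' := mul_le_mul_of_nonneg_left h (mul_nonneg (hg a) (hg b))
    simp only [hΦ, hφ, hKsym b a, Nat.cast_sub ha1, Nat.cast_sub hb1, Nat.cast_add, Nat.cast_one]
    calc _ = _ := by ring
      _ ≤ _ := h'
      _ = _ := by ring
  have hsymm : ∑ a ∈ Finset.Ico 1 N, ∑ b ∈ Finset.Ico 1 N, Φ a b
      ≤ 28 * Cq * (∑ j ∈ Finset.Ico 1 N, (j : ℝ) * g j) * ∑ j ∈ Finset.Ico 1 N, φ j * g j := by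
    have h1 : 2 * ∑ a ∈ Finset.Ico 1 N, ∑ b ∈ Finset.Ico 1 N, Φ a b
        = ∑ a ∈ Finset.Ico 1 N, ∑ b ∈ Finset.Ico 1 N, (Φ a b + Φ b a) := by
      simp_rw [Finset.sum_add_distrib]
      rw [Finset.sum_comm (f := fun a b => Φ b a)]
      ring
    have h2 : ∑ a ∈ Finset.Ico 1 N, ∑ b ∈ Finset.Ico 1 N, (Φ a b + Φ b a)
        ≤ ∑ a ∈ Finset.Ico 1 N, ∑ b ∈ Finset.Ico 1 N,
          28 * Cq * ((φ a * g a) * (b * g b) + (a * g a) * (φ b * g b)) :=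
      Finset.sum_le_sum fun a ha => Finset.sum_le_sum fun b hb => hpair a ha b hb
    have h3 : ∑ a ∈ Finset.Ico 1 N, ∑ b ∈ Finset.Ico 1 N,
          28 * Cq * ((φ a * g a) * (b * g b) + (a * g a) * (φ b * g b))
        = 2 * (28 * Cq * (∑ j ∈ Finset.Ico 1 N, (j : ℝ) * g j)
          * ∑ j ∈ Finset.Ico 1 N, φ j * g j) := by
      simp_rw [← Finset.mul_sum, Finset.sum_add_distrib, ← Finset.mul_sum, ← Finset.sum_mul]
      ring
    linarith
  refine (hsplit.trans hsymm).trans ?_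
  have n3 := n1.trans hs1
  gcongr

/-- Approximate solutions with uniform estimates. -/
lemma exists_truncated_solution_moments {K : ℕ → ℕ → ℝ} {Cq μ ν p : ℝ} (hK : ∀ j k, 0 ≤ K j k)
    (hKsym : ∀ j k, K j k = K k j)
    (hCq : 0 ≤ Cq) (hμp : μ ≤ p) (hνp : ν ≤ p) (hp1 : 1 ≤ p) (hp2 : p ≤ 2) (hμν : μ + ν ≤ 3)
    (hKle : ∀ j k : ℕ, K j k ≤ Cq * ((j : ℝ) ^ μ * (k : ℝ) ^ ν + (j : ℝ) ^ ν * (k : ℝ) ^ μ))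
    (N : ℕ) {f0 : ℕ → ℝ} {m M : ℝ} (h0 : ∀ j, 0 ≤ f0 j) (h0m : ∀ j, f0 j ≤ m)
    (hsum : ∑ j ∈ Finset.range (N + 1), f0 j ≤ m)
    (hmass : ∑ j ∈ Finset.range (N + 1), (j : ℝ) * f0 j ≤ M) {T : ℝ} (hT : 0 ≤ T) :
    ∃ u : ℝ → ℕ → ℝ, u 0 = f0 ∧ (∀ t ∈ Icc 0 T, ∀ j, 0 ≤ u t j) ∧
      (∀ t ∈ Icc 0 T, ∑ j ∈ Finset.range (N + 1), u t j ≤ m) ∧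
      (∀ t ∈ Icc 0 T, ∀ R, 1 ≤ R → ∑ j ∈ Finset.range (N + 1), tailWeight p R j * u t j
        ≤ (∑ j ∈ Finset.range (N + 1), tailWeight p R j * f0 j)
          * Real.exp (28 * Cq * M * t)) ∧
      ∀ t ∈ Icc 0 T, ∀ j,
        HasDerivWithinAt (fun s => u s j) (exchField K N (u t) j) (Icc 0 T) t := by
  obtain ⟨u, hu0, hnn, hc, hu⟩ := exists_truncated_solution hK N h0 h0m hsum hT
  have hderiv : ∀ φ : ℕ → ℝ, ∀ t ∈ Icc 0 T,
      HasDerivWithinAt (fun s => ∑ j ∈ Finset.range (N + 1), φ j * u s j)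
        (∑ j ∈ Finset.range (N + 1), φ j * exchField K N (u t) j) (Icc 0 T) t := fun φ t ht =>
    HasDerivWithinAt.fun_sum fun j _ => (hu t ht j).const_mul (φ j)
  have hM : ∀ t ∈ Icc 0 T, ∑ j ∈ Finset.range (N + 1), (j : ℝ) * u t j ≤ M := by
    intro t ht
    have := eq_of_deriv_eq_zero (g := fun s => ∑ j ∈ Finset.range (N + 1), (j : ℝ) * u s j)
      (T := T) ?_ t ht
    · rwa [this, hu0]
    · intro s hs
      convert! hderiv (fun j => (j : ℝ)) s hs using 1
      rw [sum_mul_exchField]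
      refine (Finset.sum_eq_zero fun a ha => Finset.sum_eq_zero fun b _ => ?_).symm
      rw [Nat.cast_sub (Finset.mem_Ico.1 ha).1]
      push_cast
      ring
  refine ⟨u, hu0, hnn, hc, fun t ht R hR => ?_, hu⟩
  have := le_mul_exp_of_deriv_le (C := 28 * Cq * M) (hderiv (fun j => tailWeight p R j)) ?_ t ht
  · simpa [hu0] using this
  · intro s hs
    refine (sum_tailWeight_mul_exchField_le hK hKsym hCq hμp hνp hp1 hp2 hμν hKle hR N
      (hnn s hs)).trans ?_
    have : 0 ≤ ∑ j ∈ Finset.range (N + 1), tailWeight p R j * u s j :=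
      Finset.sum_nonneg fun j _ =>
        mul_nonneg (tailWeight_nonneg hR (Nat.cast_nonneg j)) (hnn s hs j)
    have := hM s hs
    gcongr
/-! ### Compactness and passage to the limit -/

lemma exists_subseq_tendsto_of_equilipschitz {u : ℕ → ℝ → ℕ → ℝ} {m : ℝ}
    (hb : ∀ t, 0 ≤ t → ∀ j, ∀ᶠ n in atTop, u n t j ∈ Icc 0 m)
    (hlip : ∀ T : ℝ, ∀ j : ℕ, ∃ L : ℝ, ∀ᶠ n in atTop, ∀ s ∈ Icc 0 T, ∀ t ∈ Icc 0 T,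
      |u n t j - u n s j| ≤ L * |t - s|) :
    ∃ ψ : ℕ → ℕ, StrictMono ψ ∧ ∃ f : ℝ → ℕ → ℝ, ∀ t, 0 ≤ t → ∀ j,
      Tendsto (fun n => u (ψ n) t j) atTop (𝓝 (f t j)) := by
  have hm : 0 ≤ m := by
    obtain ⟨n, hn⟩ := (hb 0 le_rfl 0).exists
    exact hn.1.trans hn.2
  let w : ℕ → ℚ × ℕ → ℝ := fun n q => max 0 (min (u n q.1 q.2) m)
  have hK : IsCompact (Set.pi univ fun _ : ℚ × ℕ => Icc (0 : ℝ) m) :=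
    isCompact_univ_pi fun _ => isCompact_Icc
  obtain ⟨x, -, ψ, hψ, hx⟩ := hK.tendsto_subseq (x := w) fun n q _ =>
    ⟨le_max_left _ _, max_le hm (min_le_right _ _)⟩
  refine ⟨ψ, hψ, ?_⟩
  have hrat : ∀ q : ℚ, (0 : ℝ) ≤ q → ∀ j,
      Tendsto (fun n => u (ψ n) q j) atTop (𝓝 (x (q, j))) := by
    intro q hq j
    refine ((tendsto_pi_nhds.1 hx) (q, j)).congr' ?_
    filter_upwards [hψ.tendsto_atTop.eventually (hb q hq j)] with n hn
    simp only [Function.comp, w]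
    rw [min_eq_left hn.2, max_eq_right hn.1]
  have hconv : ∀ t, 0 ≤ t → ∀ j, ∃ y, Tendsto (fun n => u (ψ n) t j) atTop (𝓝 y) := by
    intro t ht j
    apply cauchySeq_tendsto_of_complete
    rw [Metric.cauchySeq_iff']
    intro ε hε
    obtain ⟨L, hL⟩ := hlip (t + 1) j
    have hδ : 0 < min 1 (ε / (4 * (|L| + 1))) := by positivity
    obtain ⟨q, hq1, hq2⟩ := exists_rat_btwn (lt_add_of_pos_right t hδ)
    have hq3 : (q : ℝ) - t < 1 := by linarith [min_le_left 1 (ε / (4 * (|L| + 1)))]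
    have hq4 : (q : ℝ) - t < ε / (4 * (|L| + 1)) := by
      linarith [min_le_right 1 (ε / (4 * (|L| + 1)))]
    have hLq : L * |t - q| ≤ ε / 4 := by
      rw [abs_sub_comm, abs_of_pos (by linarith)]
      rw [lt_div_iff₀ (by positivity)] at hq4
      nlinarith [le_abs_self L]
    have hev : ∀ᶠ n in atTop, dist (u (ψ n) t j) (x (q, j)) < ε / 2 := by
      filter_upwards [hψ.tendsto_atTop.eventually hL,
        (Metric.tendsto_nhds.1 (hrat q (by linarith) j)) (ε / 4) (by linarith)] with n h1 h2
      have h3 := h1 q ⟨by linarith, by linarith⟩ t ⟨ht, by linarith⟩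
      have h4 := dist_triangle (u (ψ n) t j) (u (ψ n) q j) (x (q, j))
      rw [Real.dist_eq (u (ψ n) t j) (u (ψ n) q j)] at h4
      linarith
    obtain ⟨n₀, hn₀⟩ := eventually_atTop.1 hev
    refine ⟨n₀, fun n hn => ?_⟩
    have := dist_triangle_right (u (ψ n) t j) (u (ψ n₀) t j) (x (q, j))
    linarith [hn₀ n hn, hn₀ n₀ le_rfl]
  choose f hf using hconv
  refine ⟨fun t j => if h : 0 ≤ t then f t h j else 0, fun t ht j => ?_⟩
  simpa only [dif_pos ht] using hf t ht j

/-- Limits of weighted sums under a uniform tail bound. -/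
lemma summable_and_tendsto_sum_of_tail {N : ℕ → ℕ} (hN : Tendsto N atTop atTop) {c y : ℕ → ℝ}
    {x : ℕ → ℕ → ℝ} (hc : ∀ k, 0 ≤ c k) (hx : ∀ᶠ n in atTop, ∀ k, 0 ≤ x n k)
    (hlim : ∀ k, Tendsto (fun n => x n k) atTop (𝓝 (y k)))
    (htail : ∀ ε > 0, ∃ R, ∀ᶠ n in atTop, ∑ k ∈ Finset.Ico R (N n), c k * x n k ≤ ε) :
    Summable (fun k => c k * y k) ∧
      Tendsto (fun n => ∑ k ∈ Finset.range (N n), c k * x n k) atTop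
        (𝓝 (∑' k, c k * y k)) := by
  have hy : ∀ k, 0 ≤ y k := fun k =>
    ge_of_tendsto (hlim k) (hx.mono fun n hn => hn k)
  have hcy : ∀ k, 0 ≤ c k * y k := fun k => mul_nonneg (hc k) (hy k)
  have hfin : ∀ s : Finset ℕ, Tendsto (fun n => ∑ k ∈ s, c k * x n k) atTop
      (𝓝 (∑ k ∈ s, c k * y k)) := fun s =>
    tendsto_finsetSum _ fun k _ => (hlim k).const_mul (c k)
  have htaily : ∀ ε R, (∀ᶠ n in atTop, ∑ k ∈ Finset.Ico R (N n), c k * x n k ≤ ε) →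
      ∀ i, R ≤ i → ∑ k ∈ Finset.range i, c k * y k ≤ ∑ k ∈ Finset.range R, c k * y k + ε := by
    intro ε R hR i hi
    rw [← Finset.sum_range_add_sum_Ico _ hi]
    gcongr
    refine le_of_tendsto (hfin _) ?_
    filter_upwards [hR, hx, hN.eventually_ge_atTop i] with n h1 h2 h3
    refine le_trans (Finset.sum_le_sum_of_subset_of_nonneg (Finset.Ico_subset_Ico_right h3)
      fun k _ _ => mul_nonneg (hc k) (h2 k)) h1
  have hsum : Summable (fun k => c k * y k) := by
    obtain ⟨R, hR⟩ := htail 1 one_pos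
    refine summable_of_sum_range_le (c := ∑ k ∈ Finset.range R, c k * y k + 1) hcy fun i => ?_
    refine le_trans (Finset.sum_le_sum_of_subset_of_nonneg (Finset.range_mono (le_max_left i R))
      fun k _ _ => hcy k) (htaily 1 R hR _ (le_max_right i R))
  refine ⟨hsum, ?_⟩
  rw [Metric.tendsto_nhds]
  intro ε hε
  obtain ⟨R, hR⟩ := htail (ε / 4) (by linarith)
  have h1 : ∑' k, c k * y k ≤ ∑ k ∈ Finset.range R, c k * y k + ε / 4 :=
    le_of_tendsto hsum.hasSum.tendsto_sum_nat
      ((eventually_ge_atTop R).mono fun i hi => htaily _ R hR i hi)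
  have h2 : ∑ k ∈ Finset.range R, c k * y k ≤ ∑' k, c k * y k :=
    hsum.sum_le_tsum _ fun k _ => hcy k
  filter_upwards [hR, hx, hN.eventually_ge_atTop R,
    (Metric.tendsto_nhds.1 (hfin (Finset.range R))) (ε / 4) (by linarith)] with n h3 h4 h5 h6
  rw [← Finset.sum_range_add_sum_Ico _ h5]
  have h7 : 0 ≤ ∑ k ∈ Finset.Ico R (N n), c k * x n k :=
    Finset.sum_nonneg fun k _ => mul_nonneg (hc k) (h4 k)
  rw [Real.dist_eq, abs_lt] at *
  constructor <;> linarith [h6.1, h6.2]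

/-- The exchange rate at size `j`, in terms of the densities `g` and the total rates `S`. -/
def exchRate (K : ℕ → ℕ → ℝ) (g S : ℕ → ℝ) : ℕ → ℝ
  | 0 => g 1 * S 1 - g 0 * (S 0 - K 0 0 * g 0)
  | j + 1 => g (j + 2) * S (j + 2) - g (j + 1) * S (j + 1)
      - g (j + 1) * (S (j + 1) - K (j + 1) 0 * g 0) + g j * (S j - K j 0 * g 0)

lemma exchField_eq_exchRate {K : ℕ → ℕ → ℝ} (hKsym : ∀ j k, K j k = K k j) {N j : ℕ}
    (hj : j + 1 < N) (g : ℕ → ℝ) :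
    exchField K N g j = exchRate K g (fun i => ∑ k ∈ Finset.range N, K i k * g k) j := by
  have hdon : ∀ i ∈ Finset.Ico 1 N, ∑ a ∈ Finset.Ico 1 N, ∑ b ∈ Finset.range N,
      K a b * (g a * g b) * (if a = i then 1 else 0)
        = g i * ∑ k ∈ Finset.range N, K i k * g k := by
    intro i hi
    simp only [mul_ite, mul_one, mul_zero, Finset.sum_ite_irrel, Finset.sum_const_zero,
      Finset.sum_ite_eq', hi, if_true]
    rw [Finset.mul_sum]
    exact Finset.sum_congr rfl fun b _ => by ring
  have hrec : ∀ i ∈ Finset.range N, ∑ a ∈ Finset.Ico 1 N, ∑ b ∈ Finset.range N,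
      K a b * (g a * g b) * (if b = i then 1 else 0)
        = g i * ((∑ k ∈ Finset.range N, K i k * g k) - K i 0 * g 0) := by
    intro i hi
    simp only [mul_ite, mul_one, mul_zero, Finset.sum_ite_eq', hi, if_true]
    have e : ∑ k ∈ Finset.range N, K i k * g k
        = K i 0 * g 0 + ∑ k ∈ Finset.Ico 1 N, K i k * g k := by
      rw [Finset.range_eq_Ico, Finset.sum_eq_sum_Ico_succ_bot (by omega)]
    rw [e, add_sub_cancel_left, Finset.mul_sum]
    exact Finset.sum_congr rfl fun b _ => by rw [hKsym]; ring
  have hexp : ∀ {J : ℕ → ℕ → ℝ}, (∀ a ∈ Finset.Ico 1 N, ∀ b, jump a b j = J a b) →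
      exchField K N g j = ∑ a ∈ Finset.Ico 1 N, ∑ b ∈ Finset.range N,
        K a b * (g a * g b) * J a b := fun h =>
    Finset.sum_congr rfl fun a ha => Finset.sum_congr rfl fun b _ => by rw [h a ha b]
  cases j with
  | zero =>
    rw [hexp (J := fun a b => (if a = 1 then 1 else 0) - (if b = 0 then 1 else 0))]
    · simp_rw [mul_sub, Finset.sum_sub_distrib]
      rw [hdon 1 (by simp; omega), hrec 0 (by simp; omega)]
      rfl
    · intro a ha b
      have := Finset.mem_Ico.1 ha
      unfold jump
      rw [if_neg (by omega : ¬ 0 = a), if_neg (by omega : ¬ 0 = b + 1)]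
      simp only [show (0 = a - 1) ↔ a = 1 by omega, eq_comm (a := 0) (b := b)]
      ring
  | succ i =>
    rw [hexp (J := fun a b => (if a = i + 2 then 1 else 0) - (if a = i + 1 then 1 else 0)
        - (if b = i + 1 then 1 else 0) + (if b = i then 1 else 0))]
    · simp_rw [mul_add, mul_sub, Finset.sum_add_distrib, Finset.sum_sub_distrib]
      rw [hdon (i + 2) (by simp; omega), hdon (i + 1) (by simp; omega),
        hrec (i + 1) (by simp; omega), hrec i (by simp; omega)]
      rfl
    · intro a ha b
      have := Finset.mem_Ico.1 ha
      unfold jump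
      simp only [show (i + 1 = a - 1) ↔ a = i + 2 by omega, show (i + 1 = a) ↔ a = i + 1 by omega,
        show (i + 1 = b + 1) ↔ b = i by omega, show (i + 1 = b) ↔ b = i + 1 by omega]
      ring

lemma exists_exchRate_bound (K : ℕ → ℕ → ℝ) (m : ℝ) (B : ℕ → ℝ) (j : ℕ) :
    ∃ L, ∀ g S : ℕ → ℝ, (∀ i ≤ j + 1, |g i| ≤ m) → (∀ i ≤ j + 1, |S i| ≤ B i) →
      |exchRate K g S j| ≤ L := by
  have hprod : ∀ {g S : ℕ → ℝ}, (∀ i ≤ j + 1, |g i| ≤ m) → (∀ i ≤ j + 1, |S i| ≤ B i) →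
      ∀ i ≤ j + 1, |g i * S i| ≤ m * B i := by
    intro g S hg hS i hi
    rw [abs_mul]
    exact mul_le_mul (hg i hi) (hS i hi) (abs_nonneg _) ((abs_nonneg _).trans (hg i hi))
  have hprod' : ∀ {g S : ℕ → ℝ}, (∀ i ≤ j + 1, |g i| ≤ m) → (∀ i ≤ j + 1, |S i| ≤ B i) →
      ∀ i ≤ j + 1, |g i * (S i - K i 0 * g 0)| ≤ m * (B i + |K i 0| * m) := by
    intro g S hg hS i hi
    have hm := (abs_nonneg _).trans (hg i hi)
    rw [abs_mul]
    refine mul_le_mul (hg i hi) ((abs_sub _ _).trans ?_) (abs_nonneg _) hm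
    rw [abs_mul]
    have := hS i hi
    have := hg 0 (Nat.zero_le _)
    gcongr
  cases j with
  | zero =>
    refine ⟨m * B 1 + m * (B 0 + |K 0 0| * m), fun g S hg hS => ?_⟩
    have h1 := hprod hg hS 1 (by omega)
    have h2 := hprod' hg hS 0 (by omega)
    exact (abs_sub _ _).trans (add_le_add h1 h2)
  | succ j =>
    refine ⟨m * B (j + 2) + m * B (j + 1) + m * (B (j + 1) + |K (j + 1) 0| * m)
      + m * (B j + |K j 0| * m), fun g S hg hS => ?_⟩
    have h1 := hprod hg hS (j + 2) (by omega)
    have h2 := hprod hg hS (j + 1) (by omega)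
    have h3 := hprod' hg hS (j + 1) (by omega)
    have h4 := hprod' hg hS j (by omega)
    refine (abs_add_le _ _).trans (add_le_add ((abs_sub _ _).trans (add_le_add
      ((abs_sub _ _).trans (add_le_add h1 h2)) h3)) h4)

lemma tendsto_exchRate (K : ℕ → ℕ → ℝ) {g S : ℕ → ℕ → ℝ} {g' S' : ℕ → ℝ}
    (hg : ∀ i, Tendsto (fun n => g n i) atTop (𝓝 (g' i)))
    (hS : ∀ i, Tendsto (fun n => S n i) atTop (𝓝 (S' i))) (j : ℕ) :
    Tendsto (fun n => exchRate K (g n) (S n) j) atTop (𝓝 (exchRate K g' S' j)) := by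
  have h1 : ∀ i, Tendsto (fun n => g n i * S n i) atTop (𝓝 (g' i * S' i)) := fun i =>
    (hg i).mul (hS i)
  have h2 : ∀ i, Tendsto (fun n => g n i * (S n i - K i 0 * g n 0)) atTop
      (𝓝 (g' i * (S' i - K i 0 * g' 0))) := fun i =>
    (hg i).mul ((hS i).sub ((hg 0).const_mul _))
  cases j with
  | zero => exact (h1 1).sub (h2 0)
  | succ j => exact (((h1 (j + 2)).sub (h1 (j + 1))).sub (h2 (j + 1))).add (h2 j)

lemma tendsto_tsum_tailWeight {p : ℝ} {f0 : ℕ → ℝ} (hf0 : MemYplus p f0) :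
    Tendsto (fun R : ℕ => ∑' j : ℕ, tailWeight p R j * f0 j) atTop (𝓝 0) := by
  have h : Tendsto (fun R : ℕ => ∑' j : ℕ, tailWeight p R j * f0 j) atTop
      (𝓝 (∑' _ : ℕ, (0 : ℝ))) := by
    refine tendsto_tsum_of_dominated_convergence (bound := fun j : ℕ => (j : ℝ) ^ p * f0 j)
      hf0.2 (fun j => ?_) ?_
    · have h1 : Tendsto (fun R : ℕ => (j : ℝ) / R) atTop (𝓝 0) :=
        tendsto_const_div_atTop_nhds_zero_nat (j : ℝ)
      have h2 := ((tendsto_const_nhds (x := (1 : ℝ))).min h1).const_mul ((j : ℝ) ^ p)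
      have h3 := h2.mul_const (f0 j)
      simpa [tailWeight] using h3
    · filter_upwards [eventually_ge_atTop 1] with R hR j
      have hR1 : (1 : ℝ) ≤ R := by exact_mod_cast hR
      have := tailWeight_nonneg (p := p) hR1 (Nat.cast_nonneg j)
      rw [Real.norm_of_nonneg (mul_nonneg this (hf0.1 j))]
      exact mul_le_mul_of_nonneg_right (tailWeight_le (Nat.cast_nonneg j)) (hf0.1 j)
  simpa using h

lemma continuousOn_exchField (K : ℕ → ℕ → ℝ) (N : ℕ) {g : ℝ → ℕ → ℝ} {s : Set ℝ}
    (hg : ∀ a, ContinuousOn (fun t => g t a) s) (j : ℕ) :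
    ContinuousOn (fun t => exchField K N (g t) j) s := by
  unfold exchField
  exact continuousOn_finsetSum _ fun a _ => continuousOn_finsetSum _ fun b _ =>
    (continuousOn_const.mul ((hg a).mul (hg b))).mul continuousOn_const

/-- Extraction of a global mild solution from truncated solutions with uniform tail bounds. -/
lemma exists_mild_of_truncated {K : ℕ → ℕ → ℝ} (hK : ∀ j k, 0 ≤ K j k)
    (hKsym : ∀ j k, K j k = K k j) {p m C : ℝ} (hp : 0 < p) (hC : 0 ≤ C) {D η : ℕ → ℝ}
    (hD : ∀ i, 0 ≤ D i) (hKD : ∀ i k : ℕ, 1 ≤ k → K i k ≤ D i * (k : ℝ) ^ p)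
    (hη : Tendsto η atTop (𝓝 0)) (hη0 : 0 ≤ η 1) {f0 : ℕ → ℝ} {u : ℕ → ℝ → ℕ → ℝ}
    (h0 : ∀ n, u n 0 = f0) (hu : ∀ n : ℕ, ∀ t ∈ Icc (0 : ℝ) n, ∀ j, 0 ≤ u n t j)
    (hum : ∀ n : ℕ, ∀ t ∈ Icc (0 : ℝ) n, ∀ j ≤ n, u n t j ≤ m)
    (htail : ∀ n : ℕ, ∀ t ∈ Icc (0 : ℝ) n, ∀ R : ℕ, 1 ≤ R →
      ∑ k ∈ Finset.Ico R n, (k : ℝ) ^ p * u n t k ≤ η R * Real.exp (C * t))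
    (hderiv : ∀ n : ℕ, ∀ t ∈ Icc (0 : ℝ) n, ∀ j,
      HasDerivWithinAt (fun s => u n s j) (exchField K n (u n t) j) (Icc 0 n) t) :
    ∃ f : ℝ → ℕ → ℝ, f 0 = f0 ∧ ∀ T : ℝ, 0 < T → IsMildSolutionOn K p f (Set.Ico 0 T) := by
  have hKtail : ∀ i n : ℕ, ∀ t ∈ Icc (0 : ℝ) n, ∀ R : ℕ, 1 ≤ R →
      ∑ k ∈ Finset.Ico R n, K i k * u n t k ≤ D i * (η R * Real.exp (C * t)) := by
    intro i n t ht R hR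
    refine le_trans ?_ (mul_le_mul_of_nonneg_left (htail n t ht R hR) (hD i))
    rw [Finset.mul_sum]
    refine Finset.sum_le_sum fun k hk => ?_
    rw [← mul_assoc]
    exact mul_le_mul_of_nonneg_right (hKD i k (hR.trans (Finset.mem_Ico.1 hk).1)) (hu n t ht k)
  have hSb : ∀ T : ℝ, ∀ n : ℕ, T ≤ n → 1 ≤ n → ∀ t ∈ Icc 0 T, ∀ i,
      |∑ k ∈ Finset.range n, K i k * u n t k|
        ≤ K i 0 * m + D i * (η 1 * Real.exp (C * T)) := by
    intro T n hTn hn t ht i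
    have ht' : t ∈ Icc (0 : ℝ) n := ⟨ht.1, ht.2.trans hTn⟩
    rw [abs_of_nonneg (Finset.sum_nonneg fun k _ => mul_nonneg (hK i k) (hu n t ht' k)),
      Finset.range_eq_Ico, Finset.sum_eq_sum_Ico_succ_bot hn]
    have h1 : K i 0 * u n t 0 ≤ K i 0 * m :=
      mul_le_mul_of_nonneg_left (hum n t ht' 0 (Nat.zero_le n)) (hK i 0)
    have h2 : D i * (η 1 * Real.exp (C * t)) ≤ D i * (η 1 * Real.exp (C * T)) := by
      have := hD i
      have := ht.2
      gcongr
    exact add_le_add h1 ((hKtail i n t ht' 1 le_rfl).trans h2)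
  have hfield : ∀ T : ℝ, ∀ j : ℕ, ∃ L : ℝ, ∀ᶠ n in atTop, ∀ t ∈ Icc 0 T,
      |exchField K n (u n t) j| ≤ L := by
    intro T j
    obtain ⟨L, hL⟩ := exists_exchRate_bound K m
      (fun i => K i 0 * m + D i * (η 1 * Real.exp (C * T))) j
    refine ⟨L, ?_⟩
    filter_upwards [eventually_ge_atTop (j + 2),
      tendsto_natCast_atTop_atTop.eventually_ge_atTop T] with n hn hTn t ht
    have ht' : t ∈ Icc (0 : ℝ) n := ⟨ht.1, ht.2.trans hTn⟩
    rw [exchField_eq_exchRate hKsym (by omega)]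
    refine hL _ _ (fun i hi => ?_) fun i _ => hSb T n hTn (by omega) t ht i
    rw [abs_of_nonneg (hu n t ht' i)]
    exact hum n t ht' i (by omega)
  have hlip : ∀ T : ℝ, ∀ j : ℕ, ∃ L : ℝ, ∀ᶠ n in atTop, ∀ s ∈ Icc 0 T, ∀ t ∈ Icc 0 T,
      |u n t j - u n s j| ≤ L * |t - s| := by
    intro T j
    obtain ⟨L, hL⟩ := hfield T j
    refine ⟨L, ?_⟩
    filter_upwards [hL, tendsto_natCast_atTop_atTop.eventually_ge_atTop T] with n hn hTn s hs t ht
    have hsub : Icc 0 T ⊆ Icc (0 : ℝ) n := Icc_subset_Icc_right hTn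
    exact (convex_Icc 0 T).norm_image_sub_le_of_norm_hasDerivWithin_le
      (fun x hx => (hderiv n x (hsub hx) j).mono hsub) (fun x hx => hn x hx) hs ht
  obtain ⟨ψ, hψ, f, hf⟩ := exists_subseq_tendsto_of_equilipschitz (u := u) (m := m)
    (fun t ht j => by
      filter_upwards [eventually_ge_atTop j,
        tendsto_natCast_atTop_atTop.eventually_ge_atTop t] with n hn htn
      exact ⟨hu n t ⟨ht, htn⟩ j, hum n t ⟨ht, htn⟩ j hn⟩) hlip
  have hψt := hψ.tendsto_atTop
  have hev : ∀ t : ℝ, ∀ᶠ n in atTop, t ≤ (ψ n : ℝ) := fun t =>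
    hψt.eventually (tendsto_natCast_atTop_atTop.eventually_ge_atTop t)
  have hfcont : ∀ j, ContinuousOn (fun t => f t j) (Ici 0) := by
    intro j t ht
    obtain ⟨L, hL⟩ := hlip (t + 1) j
    have hlipf : LipschitzOnWith (Real.toNNReal L) (fun s => f s j) (Icc 0 (t + 1)) := by
      refine LipschitzOnWith.of_dist_le_mul fun x hx y hy => ?_
      rw [Real.dist_eq, Real.dist_eq]
      refine le_trans (le_of_tendsto ((hf x hx.1 j).sub (hf y hy.1 j)).abs ?_)
        (mul_le_mul_of_nonneg_right (Real.le_coe_toNNReal L) (abs_nonneg _))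
      filter_upwards [hψt.eventually hL] with n hn using hn y hy x hx
    have hmem : t ∈ Icc 0 (t + 1) := ⟨ht, by linarith⟩
    refine (hlipf.continuousOn t hmem).mono_of_mem_nhdsWithin ?_
    rw [← Ici_inter_Iic]
    exact inter_mem_nhdsWithin _ (Iic_mem_nhds (by linarith))
  let F : ℝ → ℕ → ℝ := fun t => f (max t 0)
  have hFcont : ∀ j, Continuous fun t => F t j := fun j =>
    (hfcont j).comp_continuous (continuous_id.max continuous_const) fun t => le_max_right t 0
  have hFlim : ∀ t j, Tendsto (fun n => u (ψ n) (max t 0) j) atTop (𝓝 (F t j)) := fun t j =>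
    hf _ (le_max_right t 0) j
  have hFlim' : ∀ t, 0 ≤ t → ∀ j, Tendsto (fun n => u (ψ n) t j) atTop (𝓝 (F t j)) := by
    intro t ht j
    simpa only [max_eq_left ht] using hFlim t j
  have hupos : ∀ t, ∀ᶠ n in atTop, ∀ k, 0 ≤ u (ψ n) (max t 0) k := fun t =>
    (hev (max t 0)).mono fun n hn => hu (ψ n) _ ⟨le_max_right t 0, hn⟩
  have hFpos : ∀ t j, 0 ≤ F t j := fun t j =>
    ge_of_tendsto (hFlim t j) ((hupos t).mono fun n hn => hn j)
  have hcut : ∀ A t : ℝ, ∀ ε > 0, ∃ R : ℕ, 1 ≤ R ∧ A * (η R * Real.exp (C * t)) ≤ ε := by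
    intro A t ε hε
    have h1 : Tendsto (fun R => A * (η R * Real.exp (C * t))) atTop (𝓝 0) := by
      simpa using (hη.mul_const (Real.exp (C * t))).const_mul A
    obtain ⟨R, h2, h3⟩ := ((eventually_ge_atTop 1).and (h1.eventually_lt_const hε)).exists
    exact ⟨R, h2, h3.le⟩
  have hmom : ∀ t, Summable (fun k : ℕ => (k : ℝ) ^ p * F t k) ∧
      Tendsto (fun n => ∑ k ∈ Finset.range (ψ n), (k : ℝ) ^ p * u (ψ n) (max t 0) k) atTop
        (𝓝 (∑' k : ℕ, (k : ℝ) ^ p * F t k)) := fun t =>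
    summable_and_tendsto_sum_of_tail hψt (fun k => by positivity) (hupos t) (hFlim t)
      fun ε hε => by
        obtain ⟨R, hR, h⟩ := hcut 1 (max t 0) ε hε
        refine ⟨R, (hev (max t 0)).mono fun n hn => ?_⟩
        rw [one_mul] at h
        exact (htail (ψ n) _ ⟨le_max_right t 0, hn⟩ R hR).trans h
  have hrate : ∀ i t, Summable (fun k : ℕ => K i k * F t k) ∧
      Tendsto (fun n => ∑ k ∈ Finset.range (ψ n), K i k * u (ψ n) (max t 0) k) atTop
        (𝓝 (∑' k : ℕ, K i k * F t k)) := fun i t =>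
    summable_and_tendsto_sum_of_tail hψt (hK i) (hupos t) (hFlim t)
      fun ε hε => by
        obtain ⟨R, hR, h⟩ := hcut (D i) (max t 0) ε hε
        exact ⟨R, (hev (max t 0)).mono fun n hn =>
          (hKtail i (ψ n) _ ⟨le_max_right t 0, hn⟩ R hR).trans h⟩
  have hmomle : ∀ T : ℝ, ∀ t ∈ Set.Ico 0 T,
      ∑' k : ℕ, (k : ℝ) ^ p * F t k ≤ η 1 * Real.exp (C * T) := by
    intro T t ht
    refine le_of_tendsto (hmom t).2 ?_
    filter_upwards [hev t, hψt.eventually_ge_atTop 1] with n hn hn1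
    rw [max_eq_left ht.1, Finset.range_eq_Ico, Finset.sum_eq_sum_Ico_succ_bot hn1, Nat.cast_zero,
      Real.zero_rpow hp.ne', zero_mul, zero_add]
    refine (htail (ψ n) t ⟨ht.1, hn⟩ 1 le_rfl).trans ?_
    have := ht.2.le
    gcongr
  have hratele : ∀ (i : ℕ) (T : ℝ), ∀ t ∈ Set.Icc 0 T,
      |∑' k : ℕ, K i k * F t k| ≤ K i 0 * m + D i * (η 1 * Real.exp (C * T)) := by
    intro i T t ht
    refine le_of_tendsto (hrate i t).2.abs ?_
    filter_upwards [hev T, hψt.eventually_ge_atTop 1] with n hn hn1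
    rw [max_eq_left ht.1]
    exact hSb T (ψ n) hn hn1 t ht i
  have hmeas : ∀ i, Measurable fun t => ∑' k : ℕ, K i k * F t k := fun i =>
    measurable_of_tendsto_metrizable
      (f := fun n t => ∑ k ∈ Finset.range n, K i k * F t k)
      (fun n => (continuous_finsetSum _ fun k _ => continuous_const.mul (hFcont k)).measurable)
      (tendsto_pi_nhds.2 fun t => (hrate i t).1.hasSum.tendsto_sum_nat)
  have hF0 : F 0 = f0 := by
    funext j
    refine tendsto_nhds_unique (hFlim' 0 le_rfl j) ?_
    simp only [h0]
    exact tendsto_const_nhds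
  have hint : ∀ t, 0 ≤ t → ∀ j, F t j = F 0 j
      + ∫ s in (0 : ℝ)..t, exchRate K (F s) (fun i => ∑' k : ℕ, K i k * F s k) j := by
    intro t ht j
    have hftc : ∀ᶠ n in atTop, u (ψ n) t j
        = f0 j + ∫ s in (0 : ℝ)..t, exchField K (ψ n) (u (ψ n) s) j := by
      filter_upwards [hev t] with n hn
      have hsub : Icc 0 t ⊆ Icc (0 : ℝ) (ψ n) := Icc_subset_Icc_right hn
      have hc : ∀ a, ContinuousOn (fun s => u (ψ n) s a) (Icc 0 t) := fun a s hs =>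
        ((hderiv (ψ n) s (hsub hs) a).mono hsub).continuousWithinAt
      rw [intervalIntegral.integral_eq_sub_of_hasDerivAt_of_le ht (hc j), h0]
      · ring
      · intro s hs
        exact (hderiv (ψ n) s (hsub (Ioo_subset_Icc_self hs)) j).hasDerivAt
          (Icc_mem_nhds hs.1 (hs.2.trans_le hn))
      · refine ContinuousOn.intervalIntegrable ?_
        rw [uIcc_of_le ht]
        exact continuousOn_exchField K (ψ n) hc j
    refine tendsto_nhds_unique (hFlim' t ht j) (Tendsto.congr' (hftc.mono fun n hn => hn.symm) ?_)
    rw [hF0]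
    refine Tendsto.const_add _ ?_
    obtain ⟨L, hL⟩ := hfield t j
    refine intervalIntegral.tendsto_integral_filter_of_dominated_convergence (fun _ => L) ?_ ?_
      intervalIntegrable_const ?_
    · filter_upwards [hev t] with n hn
      have hsub : Icc 0 t ⊆ Icc (0 : ℝ) (ψ n) := Icc_subset_Icc_right hn
      rw [uIoc_of_le ht]
      refine (ContinuousOn.mono (continuousOn_exchField K (ψ n) (fun a s hs =>
        ((hderiv (ψ n) s (hsub hs) a).mono hsub).continuousWithinAt) j)
        Ioc_subset_Icc_self).aestronglyMeasurable measurableSet_Ioc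
    · filter_upwards [hψt.eventually hL] with n hn
      refine Eventually.of_forall fun s hs => ?_
      rw [uIoc_of_le ht] at hs
      exact hn s (Ioc_subset_Icc_self hs)
    · refine Eventually.of_forall fun s hs => ?_
      rw [uIoc_of_le ht] at hs
      have hrate' := fun i => (hrate i s).2
      simp only [max_eq_left hs.1.le] at hrate'
      refine (tendsto_exchRate K (hFlim' s hs.1.le) hrate' j).congr' ?_
      filter_upwards [hψt.eventually_ge_atTop (j + 2)] with n hn
      exact (exchField_eq_exchRate hKsym (by omega) _).symm
  have hshift : ∀ j s, ∑' k : ℕ, K (k + 1) j * F s (k + 1)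
      = (∑' k : ℕ, K j k * F s k) - K j 0 * F s 0 := by
    intro j s
    rw [(hrate j s).1.tsum_eq_zero_add, add_sub_cancel_left]
    exact tsum_congr fun k => by rw [hKsym]
  refine ⟨F, hF0, fun T _ => ⟨fun t _ => ⟨hFpos t, (hmom t).1⟩,
    fun j => (hFcont j).continuousOn, ⟨_, hmomle T⟩, fun t _ j => (hrate j t).1,
    fun t _ j => ?_, fun t ht => ?_, fun t ht j => ?_⟩⟩
  · refine Measure.integrableOn_of_bounded (M := K j 0 * m + D j * (η 1 * Real.exp (C * t)))
      (by simp) (hmeas j).aestronglyMeasurable ?_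
    exact (ae_restrict_iff' measurableSet_Icc).2
      (Eventually.of_forall fun s hs => hratele j t s hs)
  · simp only [hshift]
    exact hint t ht.1 0
  · simp only [hshift]
    exact hint t ht.1 (j + 1)

lemma kernel_le_mul_rpow {K : ℕ → ℕ → ℝ} {Cq μ ν p : ℝ} (hCq : 0 ≤ Cq) (hμp : μ ≤ p)
    (hνp : ν ≤ p)
    (hKle : ∀ j k : ℕ, K j k ≤ Cq * ((j : ℝ) ^ μ * (k : ℝ) ^ ν + (j : ℝ) ^ ν * (k : ℝ) ^ μ))
    {i k : ℕ} (hk : 1 ≤ k) :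
    K i k ≤ Cq * ((i : ℝ) ^ μ + (i : ℝ) ^ ν) * (k : ℝ) ^ p := by
  have hk1 : (1 : ℝ) ≤ k := by exact_mod_cast hk
  have h1 := Real.rpow_le_rpow_of_exponent_le hk1 hμp
  have h2 := Real.rpow_le_rpow_of_exponent_le hk1 hνp
  calc K i k ≤ Cq * ((i : ℝ) ^ μ * (k : ℝ) ^ ν + (i : ℝ) ^ ν * (k : ℝ) ^ μ) := hKle i k
    _ ≤ Cq * ((i : ℝ) ^ μ * (k : ℝ) ^ p + (i : ℝ) ^ ν * (k : ℝ) ^ p) := by gcongr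
    _ = _ := by ring

lemma MemYplus.mono {p q : ℝ} (hqp : q ≤ p) {g : ℕ → ℝ} (hg : MemYplus p g) :
    MemYplus q g := by
  refine ⟨hg.1, (summable_nat_add_iff 1).1 ?_⟩
  refine Summable.of_nonneg_of_le (fun j => mul_nonneg (by positivity) (hg.1 _)) (fun j => ?_)
    ((summable_nat_add_iff 1).2 hg.2)
  have hj : (1 : ℝ) ≤ (j + 1 : ℕ) := by push_cast; linarith [Nat.cast_nonneg (α := ℝ) j]
  exact mul_le_mul_of_nonneg_right (Real.rpow_le_rpow_of_exponent_le hj hqp) (hg.1 _)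


end Auxiliary

/-- Theorem 2.2(a), global existence for `λ = max{μ,ν} > 1`. -/
theorem edg_global_existence_high (K : ℕ → ℕ → ℝ) (Cq μ ν : ℝ) (f0 : ℕ → ℝ)
    (hKnn : ∀ j k : ℕ, 0 ≤ K j k) (hKsym : ∀ j k : ℕ, K j k = K k j) (hCq : 0 < Cq)
    (hμ : μ ∈ Set.Icc (0:ℝ) 2) (hν : ν ∈ Set.Icc (0:ℝ) 2) (hμν : μ + ν ≤ 3)
    (hKle : ∀ j k : ℕ, K j k ≤ Cq * ((j : ℝ) ^ μ * (k : ℝ) ^ ν + (j : ℝ) ^ ν * (k : ℝ) ^ μ))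
    (hlam : 1 < max μ ν) (hf0 : MemYplus (max μ ν) f0) :
    ∃ f : ℝ → ℕ → ℝ, f 0 = f0 ∧
      ∀ T : ℝ, 0 < T → IsMildSolutionOn K (max μ ν) f (Set.Ico 0 T) := by
  set p := max μ ν
  have hf1 := hf0.mono hlam.le
  have hf2 := hf0.mono (zero_le_one.trans hlam.le)
  have hs0 : Summable f0 := by simpa using hf2.2
  have hs1 : Summable fun j : ℕ => (j : ℝ) * f0 j := by simpa using hf1.2
  have hw : ∀ R : ℝ, 1 ≤ R → ∀ j : ℕ, 0 ≤ tailWeight p R j * f0 j := fun R hR j =>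
    mul_nonneg (tailWeight_nonneg hR (Nat.cast_nonneg j)) (hf0.1 j)
  have hM : 0 ≤ ∑' j : ℕ, (j : ℝ) * f0 j :=
    tsum_nonneg fun j => mul_nonneg (Nat.cast_nonneg j) (hf0.1 j)
  choose u h0 hu hum htail hderiv using fun n : ℕ =>
    exists_truncated_solution_moments hKnn hKsym hCq.le (le_max_left μ ν) (le_max_right μ ν)
      hlam.le (max_le hμ.2 hν.2) hμν hKle n hf0.1 (fun j => hs0.le_tsum j fun i _ => hf0.1 i)
      (hs0.sum_le_tsum _ fun i _ => hf0.1 i)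
      (hs1.sum_le_tsum _ fun i _ => mul_nonneg (Nat.cast_nonneg i) (hf0.1 i)) (Nat.cast_nonneg n)
  refine exists_mild_of_truncated hKnn hKsym (C := 28 * Cq * ∑' j : ℕ, (j : ℝ) * f0 j)
    (by linarith) (by positivity) (D := fun i => Cq * ((i : ℝ) ^ μ + (i : ℝ) ^ ν))
    (fun i => by positivity)
    (fun i k hk => kernel_le_mul_rpow hCq.le (le_max_left μ ν) (le_max_right μ ν) hKle hk)
    (tendsto_tsum_tailWeight hf0) (tsum_nonneg (hw _ (by simp))) h0 hu (m := ∑' j, f0 j)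
    (fun n t ht j hj => ?_) (fun n t ht R hR => ?_) hderiv
  · exact (Finset.single_le_sum (fun i _ => hu n t ht i) (Finset.mem_range.2 (by omega))).trans
      (hum n t ht)
  · have hR' : (1 : ℝ) ≤ R := by exact_mod_cast hR
    have hsw : Summable fun j : ℕ => tailWeight p R j * f0 j :=
      Summable.of_nonneg_of_le (hw R hR')
        (fun j => mul_le_mul_of_nonneg_right (tailWeight_le (Nat.cast_nonneg j)) (hf0.1 j)) hf0.2
    calc ∑ k ∈ Finset.Ico R n, (k : ℝ) ^ p * u n t k
        = ∑ k ∈ Finset.Ico R n, tailWeight p R k * u n t k :=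
          Finset.sum_congr rfl fun k hk => by
            rw [tailWeight_eq_of_le hR' (by exact_mod_cast (Finset.mem_Ico.1 hk).1)]
      _ ≤ ∑ k ∈ Finset.range (n + 1), tailWeight p R k * u n t k :=
          Finset.sum_le_sum_of_subset_of_nonneg
            (fun k hk => Finset.mem_range.2 (by have := Finset.mem_Ico.1 hk; omega))
            fun k _ _ => mul_nonneg (tailWeight_nonneg hR' (Nat.cast_nonneg k)) (hu n t ht k)
      _ ≤ _ := (htail n t ht R hR').trans (mul_le_mul_of_nonneg_right
          (hsw.sum_le_tsum _ fun j _ => hw R hR' j) (Real.exp_pos _).le)
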